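/- Let Der_K(φ,B) denote the B-module of all φ-derivations A → B (with pointwise operations), and let d^B_φ : A → Hom_B(Der_K(φ,B), B) be the map given by d^B_φ(f)(D) = D(f). Let (Ω_φ, d_φ) be a universal φ-derivation. Then (Hom_B(Der_K(φ,B), B), d^B_φ) is a universal φ-derivation if and only if Ω_φ is a reflexive B-module, i.e. the canonical B-linear map from Ω_φ to its double dual Hom_B(Hom_B(Ω_φ,B),B) is bijective. -/

import Mathlib

universe u

variable {K A B : Type u} [CommRing K] [CommRing A] [CommRing B] [Algebra K A] [Algebra K B]

/-- A `φ`-derivation with values in a `B`-module `M`. -/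
def IsPhiDerivation (φ : A →ₐ[K] B)
    {M : Type u} [AddCommGroup M] [Module K M] [Module B M] [IsScalarTower K B M]
    (D : A →ₗ[K] M) : Prop :=
  ∀ f g : A, D (f * g) = φ f • D g + φ g • D f

/-- `(Ω, d)` is a universal `φ`-derivation. -/
def IsUniversalPhiDerivation (φ : A →ₐ[K] B)
    {Ω : Type u} [AddCommGroup Ω] [Module K Ω] [Module B Ω] [IsScalarTower K B Ω]
    (d : A →ₗ[K] Ω) : Prop :=
  IsPhiDerivation φ d ∧
    ∀ (M : Type u) [AddCommGroup M] [Module K M] [Module B M] [IsScalarTower K B M],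
      ∀ D : A →ₗ[K] M, IsPhiDerivation φ D → ∃! F : Ω →ₗ[B] M, ∀ a : A, F (d a) = D a

/-- The `B`-module `Der_K(φ, B)` of all `φ`-derivations `A → B`. -/
def phiDer (φ : A →ₐ[K] B) : Submodule B (A →ₗ[K] B) where
  carrier := {D | IsPhiDerivation φ D}
  add_mem' := by
    intro D D' hD hD' f g
    simp only [LinearMap.add_apply, hD f g, hD' f g, smul_add]
    abel
  zero_mem' := by intro f g; simp
  smul_mem' := by
    intro c D hD f g
    simp only [LinearMap.smul_apply, hD f g, smul_add, smul_comm c]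

/-- The map `d^B_φ : A → Hom_B(Der_K(φ,B), B)`, `d^B_φ(f)(D) = D(f)`. -/
def dBPhi (φ : A →ₐ[K] B) : A →ₗ[K] (phiDer φ →ₗ[B] B) where
  toFun f :=
    { toFun := fun D => (D : A →ₗ[K] B) f
      map_add' := by intro D D'; rfl
      map_smul' := by intro c D; rfl }
  map_add' := by intro f g; ext D; simp
  map_smul' := by intro c f; ext D; simp

section

variable {φ : A →ₐ[K] B}
  {M : Type u} [AddCommGroup M] [Module K M] [Module B M] [IsScalarTower K B M]
  {N : Type u} [AddCommGroup N] [Module K N] [Module B N] [IsScalarTower K B N]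

theorem IsPhiDerivation.comp {d : A →ₗ[K] M} (hd : IsPhiDerivation φ d) (F : M →ₗ[B] N) :
    IsPhiDerivation φ (F.restrictScalars K ∘ₗ d) := by
  intro f g
  simp [hd f g]

theorem isPhiDerivation_dBPhi (φ : A →ₐ[K] B) : IsPhiDerivation φ (dBPhi φ) := by
  intro f g
  ext D
  exact D.2 f g

theorem IsUniversalPhiDerivation.hom_ext {d : A →ₗ[K] M} (hd : IsUniversalPhiDerivation φ d)
    {F G : M →ₗ[B] N} (h : ∀ a, F (d a) = G (d a)) : F = G :=
  (hd.2 N (G.restrictScalars K ∘ₗ d) (hd.1.comp G)).unique h fun _ => rfl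

/-- A `φ`-derivation obtained from a universal one by composition with a `B`-linear map `F` is
universal if and only if `F` is bijective. -/
theorem IsUniversalPhiDerivation.iff_bijective {d : A →ₗ[K] M} (hd : IsUniversalPhiDerivation φ d)
    {d' : A →ₗ[K] N} {F : M →ₗ[B] N} (hF : ∀ a, F (d a) = d' a) :
    IsUniversalPhiDerivation φ d' ↔ Function.Bijective F := by
  constructor
  · intro hd'
    obtain ⟨G, hG, -⟩ := hd'.2 M d hd.1
    have hGF : G ∘ₗ F = LinearMap.id := hd.hom_ext fun a => by simp [hF, hG]
    have hFG : F ∘ₗ G = LinearMap.id := hd'.hom_ext fun a => by simp [hF, hG]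
    exact Function.bijective_iff_has_inverse.2
      ⟨G, LinearMap.congr_fun hGF, LinearMap.congr_fun hFG⟩
  · intro hbij
    have hd'_eq : F.restrictScalars K ∘ₗ d = d' := LinearMap.ext hF
    refine ⟨hd'_eq ▸ hd.1.comp F, fun P _ _ _ _ D hD => ?_⟩
    obtain ⟨G, hG, -⟩ := hd.2 P D hD
    let e := LinearEquiv.ofBijective F hbij
    have he (a : A) : e.symm (d' a) = d a := e.symm_apply_eq.2 (hF a).symm
    refine ⟨G ∘ₗ e.symm.toLinearMap, fun a => by simp [he, hG], fun H hH => ?_⟩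
    have hHF : H ∘ₗ F = G := hd.hom_ext fun a => by simp [hF, hH, hG]
    ext x
    obtain ⟨y, rfl⟩ := e.surjective x
    simp only [LinearMap.comp_apply, LinearEquiv.coe_coe, e.symm_apply_apply]
    exact LinearMap.congr_fun hHF y

/-- Composition with a `φ`-derivation `d`, as a linear map from the dual module to `Der_K(φ, B)`. -/
def IsPhiDerivation.dualToPhiDer {d : A →ₗ[K] M} (hd : IsPhiDerivation φ d) :
    Module.Dual B M →ₗ[B] phiDer φ where
  toFun F := ⟨F.restrictScalars K ∘ₗ d, hd.comp F⟩
  map_add' _ _ := rfl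
  map_smul' _ _ := rfl

theorem IsUniversalPhiDerivation.bijective_dualToPhiDer {d : A →ₗ[K] M}
    (hd : IsUniversalPhiDerivation φ d) : Function.Bijective hd.1.dualToPhiDer := by
  refine ⟨fun F G h => hd.hom_ext fun a => ?_, fun D => ?_⟩
  · exact LinearMap.congr_fun (congrArg Subtype.val h) a
  · obtain ⟨F, hF, -⟩ := hd.2 B D.1 D.2
    exact ⟨F, Subtype.ext (LinearMap.ext hF)⟩

end

/-- `(Hom_B(Der_K(φ,B), B), d^B_φ)` is a universal `φ`-derivation iff the module of
`φ`-differentials `Ω_φ` is a reflexive `B`-module. -/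
theorem dBPhi_universal_iff_reflexive (φ : A →ₐ[K] B)
    {Ω : Type u} [AddCommGroup Ω] [Module K Ω] [Module B Ω] [IsScalarTower K B Ω]
    (d : A →ₗ[K] Ω) (hd : IsUniversalPhiDerivation φ d) :
    IsUniversalPhiDerivation φ (dBPhi φ) ↔ Function.Bijective (Module.Dual.eval B Ω) := by
  obtain ⟨F, hF, -⟩ := hd.2 _ (dBPhi φ) (isPhiDerivation_dBPhi φ)
  let e := LinearEquiv.ofBijective hd.1.dualToPhiDer hd.bijective_dualToPhiDer
  have heval : e.dualMap.toLinearMap ∘ₗ F = Module.Dual.eval B Ω := hd.hom_ext fun a => by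
    ext G
    simp only [LinearMap.comp_apply, hF]
    rfl
  rw [hd.iff_bijective hF, ← heval]
  exact (e.dualMap.bijective.of_comp_iff' F).symm
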